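/- arXiv:2003.12335 — 2 statements merged into one kernel-verified Lean document; each statement's English description precedes it below -/
import Mathlib

section
/- For the punctured plane Ω = ℂ∖{0}, the Hurwitz density is given by the explicit formula η_Ω(w) = 1/(8|w|) for every w ∈ Ω. -/
open Complex Set Metric
open scoped ENNReal

noncomputable section

/-- The open unit disk in the complex plane. -/
def unitDisk : Set ℂ := Metric.ball (0 : ℂ) 1

/-- A plane domain: a nonempty open connected subset of ℂ. -/
def IsPlaneDomain (S : Set ℂ) : Prop := IsOpen S ∧ IsConnected S

/-- The Hurwitz radius `r_Ω(w)`: the supremum of `h'(0)` over all holomorphic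
`h : 𝔻 → Ω` with `h 0 = w`, `h t ≠ w` for `t ∈ 𝔻 \ {0}`, and `h'(0) > 0` (real). -/
def hurwitzRadius (Ω : Set ℂ) (w : ℂ) : ℝ :=
  sSup { r : ℝ | 0 < r ∧ ∃ h : ℂ → ℂ, DifferentiableOn ℂ h unitDisk ∧
    Set.MapsTo h unitDisk Ω ∧ h 0 = w ∧ (∀ t ∈ unitDisk, t ≠ 0 → h t ≠ w) ∧
    deriv h 0 = (r : ℂ) }

/-- The Hurwitz density `η_Ω(w) = 2 / r_Ω(w)`. -/
def hurwitzDensity (Ω : Set ℂ) (w : ℂ) : ℝ := 2 / hurwitzRadius Ω w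

/-- A (C¹, hence rectifiable) path in `Ω` from `w₁` to `w₂`, parametrized on `[0,1]`. -/
def IsPathIn (Ω : Set ℂ) (w₁ w₂ : ℂ) (γ : ℝ → ℂ) : Prop :=
  γ 0 = w₁ ∧ γ 1 = w₂ ∧ (∀ t ∈ Set.Icc (0:ℝ) 1, γ t ∈ Ω) ∧
    ContDiffOn ℝ 1 γ (Set.Icc (0:ℝ) 1)

/-- The Hurwitz distance: infimum of Hurwitz lengths of rectifiable paths in `Ω`. -/
def hurwitzDist (Ω : Set ℂ) (w₁ w₂ : ℂ) : ℝ :=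
  sInf { L : ℝ | ∃ γ : ℝ → ℂ, IsPathIn Ω w₁ w₂ γ ∧
    L = ∫ t in (0:ℝ)..1, hurwitzDensity Ω (γ t) * ‖derivWithin γ (Set.Icc (0:ℝ) 1) t‖ }

/-- The generalized Hurwitz density `η_Ω^Y(w)` with basepoint domain `Y`
(`+∞` if no admissible map exists). -/
def genHurwitzDensity (Y Ω : Set ℂ) (w : ℂ) : ℝ≥0∞ :=
  sInf { x : ℝ≥0∞ | ∃ s ∈ Y, ∃ h : ℂ → ℂ, DifferentiableOn ℂ h Y ∧
    Set.MapsTo h Y Ω ∧ h s = w ∧ (∀ t ∈ Y, t ≠ s → h t ≠ w) ∧ deriv h s ≠ 0 ∧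
    x = ENNReal.ofReal (hurwitzDensity Y s / ‖deriv h s‖) }

/-- The generalized Hurwitz distance `η_Ω^Y(z₁,z₂)`. -/
def genHurwitzDist (Y Ω : Set ℂ) (z₁ z₂ : ℂ) : ℝ≥0∞ :=
  sInf { L : ℝ≥0∞ | ∃ γ : ℝ → ℂ, IsPathIn Ω z₁ z₂ γ ∧
    L = ∫⁻ t in Set.Icc (0:ℝ) 1,
      genHurwitzDensity Y Ω (γ t) * ENNReal.ofReal ‖derivWithin γ (Set.Icc (0:ℝ) 1) t‖ }

/-- The infinitesimal contraction constant `l_η(Ω, Y)`. -/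
def lEta (Ω Y : Set ℂ) : ℝ :=
  sSup { x : ℝ | ∃ w ∈ Ω, x = hurwitzDensity Y w / hurwitzDensity Ω w }

/-- The global contraction constant `gl_η(Ω, Y)`. -/
def glEta (Ω Y : Set ℂ) : ℝ :=
  sSup { x : ℝ | ∃ w₁ ∈ Ω, ∃ w₂ ∈ Ω, w₁ ≠ w₂ ∧
    x = hurwitzDist Y w₁ w₂ / hurwitzDist Ω w₁ w₂ }
/-- A holomorphic function on the unit disk omitting `1`, whose only zero is at the origin. -/
structure OmitsOneVanishesAtOrigin (f : ℂ → ℂ) : Prop where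
  differentiableOn : DifferentiableOn ℂ f unitDisk
  map_zero : f 0 = 0
  ne_one : ∀ z ∈ unitDisk, f z ≠ 1
  ne_zero : ∀ z ∈ unitDisk, z ≠ 0 → f z ≠ 0

lemma isOpen_unitDisk : IsOpen unitDisk := isOpen_ball

lemma zero_mem_unitDisk : (0 : ℂ) ∈ unitDisk := mem_ball_self one_pos

lemma mem_unitDisk_iff {z : ℂ} : z ∈ unitDisk ↔ ‖z‖ < 1 := by simp [unitDisk]

/-- A nonvanishing holomorphic function on the disk has a holomorphic square root with prescribed
value at the origin. -/
lemma exists_differentiableOn_sq_eq {g : ℂ → ℂ} (hg : DifferentiableOn ℂ g unitDisk)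
    (hg0 : ∀ z ∈ unitDisk, g z ≠ 0) {s : ℂ} (hs : s ^ 2 = g 0) :
    ∃ k : ℂ → ℂ, DifferentiableOn ℂ k unitDisk ∧ k 0 = s ∧ ∀ z ∈ unitDisk, k z ^ 2 = g z := by
  have hs0 : s ≠ 0 := by
    rintro rfl
    exact hg0 0 zero_mem_unitDisk (by simpa using hs.symm)
  obtain ⟨L, hL0, hL⟩ := ((hg.deriv isOpen_unitDisk).div hg hg0).isExactOn_ball.with_val_at 0 0
  have hconst : ∀ z ∈ unitDisk, g z * exp (-L z) = g 0 * exp (-L 0) := by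
    intro z hz
    have hd : ∀ x ∈ unitDisk, HasDerivAt (fun z ↦ g z * exp (-L z)) 0 x := by
      intro x hx
      have h1 := (hg.differentiableAt (isOpen_unitDisk.mem_nhds hx)).hasDerivAt
      refine (h1.mul (hL x hx).neg.cexp).congr_deriv ?_
      simp only [Pi.div_apply]
      field_simp [hg0 x hx]
      ring
    exact isOpen_unitDisk.is_const_of_deriv_eq_zero (convex_ball _ _).isPreconnected
      (fun x hx ↦ (hd x hx).differentiableAt.differentiableWithinAt)
      (fun x hx ↦ (hd x hx).deriv) hz zero_mem_unitDisk
  refine ⟨fun z ↦ s * exp (L z / 2), fun z hz ↦ ?_, by simp [hL0], fun z hz ↦ ?_⟩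
  · exact (((hL z hz).differentiableAt.div_const 2).cexp.const_mul s).differentiableWithinAt
  · have h := hconst z hz
    rw [hL0, neg_zero, exp_zero, mul_one, exp_neg, mul_inv_eq_iff_eq_mul₀ (exp_ne_zero _)] at h
    rw [mul_pow, hs, ← exp_nat_mul, h]
    congr 2
    push_cast
    ring

lemma log_norm_le_of_mul_one_add_sq {f F : ℂ} (hf : f ≠ 0) (hF : F ≠ 0)
    (h : f * (1 + F) ^ 2 = 4 * F) :
    Real.log ‖F‖ ≤ Real.log 7 + max 0 (-Real.log ‖f‖) := by
  have h7 : 0 ≤ Real.log 7 := Real.log_nonneg (by norm_num)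
  have hF' : 0 < ‖F‖ := norm_pos_iff.2 hF
  have hf' : 0 < ‖f‖ := norm_pos_iff.2 hf
  rcases le_total ‖F‖ 1 with h1 | h1
  · exact (Real.log_nonpos hF'.le h1).trans (by positivity)
  have key : f * F = 4 - 2 * f - f * F⁻¹ := by
    field_simp
    linear_combination h
  have hle : ‖f‖ * ‖F‖ ≤ 4 + 3 * ‖f‖ := by
    rw [← norm_mul, key]
    have hinv : ‖F⁻¹‖ ≤ 1 := by
      rw [norm_inv]
      exact inv_le_one_of_one_le₀ h1
    calc ‖4 - 2 * f - f * F⁻¹‖ ≤ ‖(4 : ℂ)‖ + ‖2 * f‖ + ‖f * F⁻¹‖ :=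
          (norm_sub_le _ _).trans (by gcongr; exact norm_sub_le _ _)
      _ ≤ 4 + 2 * ‖f‖ + ‖f‖ * 1 := by
          rw [norm_mul, norm_mul]
          gcongr <;> simp
      _ = 4 + 3 * ‖f‖ := by ring
  rcases le_total ‖f‖ 1 with h2 | h2
  · have h3 : Real.log (‖f‖ * ‖F‖) ≤ Real.log 7 :=
      Real.log_le_log (by positivity) (by linarith)
    rw [Real.log_mul hf'.ne' hF'.ne'] at h3
    linarith [le_max_right 0 (-Real.log ‖f‖)]
  · have h3 : Real.log ‖F‖ ≤ Real.log 7 := Real.log_le_log hF' (by nlinarith)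
    linarith [le_max_left 0 (-Real.log ‖f‖)]

lemma abs_log_norm_sq_le {f F : ℂ} (hf : f ≠ 0) (hF : F ≠ 0) (h : f * (1 + F) ^ 2 = 4 * F) :
    |Real.log ‖F ^ 2‖| ≤ 2 * Real.log 7 + (|Real.log ‖f‖| - Real.log ‖f‖) := by
  have h1 := log_norm_le_of_mul_one_add_sq hf hF h
  have h2 := log_norm_le_of_mul_one_add_sq hf (inv_ne_zero hF) (by
    field_simp
    linear_combination h)
  rw [norm_inv, Real.log_inv] at h2
  have h3 : |Real.log ‖f‖| - Real.log ‖f‖ = 2 * max 0 (-Real.log ‖f‖) := by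
    rcases le_total 0 (Real.log ‖f‖) with h | h
    · rw [abs_of_nonneg h, max_eq_left (by linarith)]
      ring
    · rw [abs_of_nonpos h, max_eq_right (by linarith)]
      ring
  rw [h3, norm_pow, Real.log_pow, abs_le]
  push_cast
  constructor <;> linarith

namespace OmitsOneVanishesAtOrigin

variable {f : ℂ → ℂ}

lemma sphere_subset {r : ℝ} (hr0 : 0 < r) (hr1 : r < 1) {z : ℂ} (hz : z ∈ sphere (0 : ℂ) |r|) :
    z ∈ unitDisk ∧ z ≠ 0 := by
  rw [mem_sphere_zero_iff_norm, abs_of_pos hr0] at hz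
  exact ⟨mem_unitDisk_iff.2 (hz ▸ hr1), norm_pos_iff.1 (hz ▸ hr0)⟩

lemma circleAverage_log_norm_of_ne_zero {g : ℂ → ℂ} (hg : DifferentiableOn ℂ g unitDisk)
    (hg0 : ∀ z ∈ unitDisk, g z ≠ 0) {r : ℝ} (hr0 : 0 < r) (hr1 : r < 1) :
    Real.circleAverage (fun z ↦ Real.log ‖g z‖) 0 r = Real.log ‖g 0‖ := by
  have hsub : closedBall (0 : ℂ) |r| ⊆ unitDisk :=
    closedBall_subset_ball (by rwa [abs_of_pos hr0])
  exact AnalyticOnNhd.circleAverage_log_norm_of_ne_zero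
    ((hg.analyticOnNhd isOpen_unitDisk).mono hsub) fun u hu ↦ hg0 u (hsub hu)

lemma continuousOn_log_norm (hf : OmitsOneVanishesAtOrigin f) {r : ℝ} (hr0 : 0 < r)
    (hr1 : r < 1) : ContinuousOn (fun z ↦ Real.log ‖f z‖) (sphere 0 |r|) :=
  (hf.differentiableOn.continuousOn.mono fun _ hz ↦ (sphere_subset hr0 hr1 hz).1).norm.log
    fun z hz ↦ norm_ne_zero_iff.2
      (hf.ne_zero z (sphere_subset hr0 hr1 hz).1 (sphere_subset hr0 hr1 hz).2)

/-- A Landen-type transformation: it doubles the logarithmic mean, up to a constant, while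
controlling the mean of the absolute value of the logarithm. -/
lemma exists_landen (hf : OmitsOneVanishesAtOrigin f) {r : ℝ} (hr0 : 0 < r) (hr1 : r < 1) :
    ∃ f₁, OmitsOneVanishesAtOrigin f₁ ∧
      Real.circleAverage (fun z ↦ Real.log ‖f₁ z‖) 0 r =
        2 * Real.circleAverage (fun z ↦ Real.log ‖f z‖) 0 r - 4 * Real.log 2 ∧
      Real.circleAverage (fun z ↦ |Real.log ‖f₁ z‖|) 0 r ≤
        2 * Real.log 7 + (Real.circleAverage (fun z ↦ |Real.log ‖f z‖|) 0 r -
          Real.circleAverage (fun z ↦ Real.log ‖f z‖) 0 r) := by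
  obtain ⟨K, hKd, hK0, hK⟩ := exists_differentiableOn_sq_eq (g := fun z ↦ 1 - f z) (s := 1)
    (hf.differentiableOn.const_sub 1) (fun z hz h ↦ hf.ne_one z hz (sub_eq_zero.1 h).symm)
    (by simp [hf.map_zero])
  have hKne : ∀ z ∈ unitDisk, K z ≠ 0 := fun z hz h ↦ hf.ne_one z hz (by
    linear_combination hK z hz - K z * h)
  have hKne1 : ∀ z ∈ unitDisk, 1 + K z ≠ 0 := by
    intro z hz h
    by_cases hz0 : z = 0
    · rw [hz0, hK0] at h
      norm_num at h
    · exact hf.ne_zero z hz hz0 (by linear_combination (1 - K z) * h + hK z hz)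
  have hKd1 : DifferentiableOn ℂ (fun z ↦ 1 + K z) unitDisk := hKd.const_add 1
  set F : ℂ → ℂ := fun z ↦ f z / (1 + K z) ^ 2 with hF
  have hFne : ∀ z ∈ unitDisk, z ≠ 0 → F z ≠ 0 := fun z hz h ↦
    div_ne_zero (hf.ne_zero z hz h) (pow_ne_zero 2 (hKne1 z hz))
  have hFK : ∀ z ∈ unitDisk, F z * (1 + K z) = 1 - K z := by
    intro z hz
    have := hKne1 z hz
    simp only [hF]
    field_simp
    linear_combination hK z hz
  have hF1 : ∀ z ∈ unitDisk, f z * (1 + F z) ^ 2 = 4 * F z := by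
    intro z hz
    have h := hKne1 z hz
    have h1 : 1 + F z = 2 / (1 + K z) := by
      rw [eq_div_iff h]
      linear_combination hFK z hz
    rw [h1]
    simp only [hF]
    field_simp
    norm_num
  have hf₁ : OmitsOneVanishesAtOrigin (fun z ↦ F z ^ 2) := by
    refine ⟨(hf.differentiableOn.div (hKd1.pow 2) fun z hz ↦ pow_ne_zero 2 (hKne1 z hz)).pow 2,
      by simp [hF, hf.map_zero], fun z hz h ↦ ?_, fun z hz h ↦ pow_ne_zero 2 (hFne z hz h)⟩
    have hFKz := hFK z hz
    rcases eq_or_eq_neg_of_sq_eq_sq (F z) 1 (h.trans (one_pow 2).symm) with h | h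
    · rw [h] at hFKz
      exact hKne z hz (by linear_combination hFKz / 2)
    · rw [h] at hFKz
      exact two_ne_zero (α := ℂ) (by linear_combination -hFKz)
  have hc := hf.continuousOn_log_norm hr0 hr1
  have hcK : ContinuousOn (fun z ↦ Real.log ‖1 + K z‖) (sphere 0 |r|) :=
    (hKd1.continuousOn.mono fun _ hz ↦ (sphere_subset hr0 hr1 hz).1).norm.log
      fun z hz ↦ norm_ne_zero_iff.2 (hKne1 z (sphere_subset hr0 hr1 hz).1)
  refine ⟨_, hf₁, ?_, ?_⟩
  · have h1 : Real.circleAverage (fun z ↦ Real.log ‖F z ^ 2‖) 0 r =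
        Real.circleAverage ((2 : ℝ) • (fun z ↦ Real.log ‖f z‖) -
          (4 : ℝ) • (fun z ↦ Real.log ‖1 + K z‖)) 0 r := by
      refine Real.circleAverage_congr_sphere fun z hz ↦ ?_
      obtain ⟨hz, hz0⟩ := sphere_subset hr0 hr1 hz
      have h2 := norm_ne_zero_iff.2 (hKne1 z hz)
      have h3 := norm_ne_zero_iff.2 (hf.ne_zero z hz hz0)
      simp only [hF, norm_pow, norm_div, Pi.sub_apply, Pi.smul_apply, smul_eq_mul]
      rw [Real.log_pow, Real.log_div h3 (pow_ne_zero 2 h2), Real.log_pow]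
      push_cast
      ring
    rw [h1, Real.circleAverage_sub (hc.const_smul (2 : ℝ)).circleIntegrable'
      (hcK.const_smul (4 : ℝ)).circleIntegrable', Real.circleAverage_smul,
      Real.circleAverage_smul, circleAverage_log_norm_of_ne_zero hKd1 hKne1 hr0 hr1, hK0]
    norm_num
  · have h1 : Real.circleAverage (fun z ↦ |Real.log ‖F z ^ 2‖|) 0 r ≤
        Real.circleAverage ((fun _ ↦ 2 * Real.log 7) +
          ((fun z ↦ |Real.log ‖f z‖|) - (fun z ↦ Real.log ‖f z‖))) 0 r := by
      refine Real.circleAverage_mono (hf₁.continuousOn_log_norm hr0 hr1).abs.circleIntegrable'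
        (continuousOn_const.add (hc.abs.sub hc)).circleIntegrable' fun z hz ↦ ?_
      obtain ⟨hz, hz0⟩ := sphere_subset hr0 hr1 hz
      exact abs_log_norm_sq_le (hf.ne_zero z hz hz0) (hFne z hz hz0) (hF1 z hz)
    rwa [Real.circleAverage_add continuousOn_const.circleIntegrable'
      (hc.abs.sub hc).circleIntegrable', Real.circleAverage_const,
      Real.circleAverage_sub hc.abs.circleIntegrable' hc.circleIntegrable'] at h1

lemma circleAverage_log_norm_le (hf : OmitsOneVanishesAtOrigin f) {r : ℝ} (hr0 : 0 < r)
    (hr1 : r < 1) : Real.circleAverage (fun z ↦ Real.log ‖f z‖) 0 r ≤ 4 * Real.log 2 := by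
  by_contra! hlt
  set L := Real.circleAverage (fun z ↦ Real.log ‖f z‖) 0 r - 4 * Real.log 2 with hL
  have hLpos : 0 < L := sub_pos.2 hlt
  set B := Real.circleAverage (fun z ↦ |Real.log ‖f z‖|) 0 r with hB
  have key : ∀ n : ℕ, ∃ g, OmitsOneVanishesAtOrigin g ∧
      Real.circleAverage (fun z ↦ Real.log ‖g z‖) 0 r = 2 ^ n * L + 4 * Real.log 2 ∧
      Real.circleAverage (fun z ↦ |Real.log ‖g z‖|) 0 r ≤
        B + n * (2 * Real.log 7) - (2 ^ n - 1) * L := by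
    intro n
    induction n with
    | zero => exact ⟨f, hf, by simp [hL], by simp [hB]⟩
    | succ n ih =>
      obtain ⟨g, hg, h1, h2⟩ := ih
      obtain ⟨g₁, hg₁, h3, h4⟩ := hg.exists_landen hr0 hr1
      refine ⟨g₁, hg₁, by rw [h3, h1]; ring, ?_⟩
      have : 0 ≤ Real.log 2 := Real.log_nonneg (by norm_num)
      rw [h1] at h4
      push_cast
      rw [pow_succ]
      linarith
  have hlim : Filter.Tendsto (fun n : ℕ ↦ (B + L + n * (2 * Real.log 7)) / 2 ^ n) Filter.atTop
      (nhds 0) := by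
    have h1 : Filter.Tendsto (fun n : ℕ ↦ ((1 : ℝ) / 2) ^ n) Filter.atTop (nhds 0) :=
      tendsto_pow_atTop_nhds_zero_of_lt_one (by norm_num) (by norm_num)
    have h2 : Filter.Tendsto (fun n : ℕ ↦ (n : ℝ) * ((1 : ℝ) / 2) ^ n) Filter.atTop (nhds 0) :=
      tendsto_self_mul_const_pow_of_lt_one (by norm_num) (by norm_num)
    have h3 := (h1.const_mul (B + L)).add (h2.const_mul (2 * Real.log 7))
    simp only [mul_zero, add_zero] at h3
    refine h3.congr fun n ↦ ?_
    rw [one_div, inv_pow]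
    ring
  obtain ⟨n, hn⟩ := (hlim.eventually_lt_const hLpos).exists
  obtain ⟨g, -, -, hg⟩ := key n
  have h0 : 0 ≤ Real.circleAverage (fun z ↦ |Real.log ‖g z‖|) 0 r :=
    Real.circleAverage_nonneg_of_nonneg fun _ _ ↦ abs_nonneg _
  rw [div_lt_iff₀ (by positivity)] at hn
  linarith

lemma dslope_ne_zero (hf : OmitsOneVanishesAtOrigin f) (hd : deriv f 0 ≠ 0) :
    ∀ z ∈ unitDisk, dslope f 0 z ≠ 0 := by
  intro z hz
  by_cases h : z = 0
  · rwa [h, dslope_same]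
  · rw [dslope_of_ne _ h, slope_def_field, hf.map_zero, sub_zero, sub_zero]
    exact div_ne_zero (hf.ne_zero z hz h) h

lemma differentiableOn_dslope_zero (hf : OmitsOneVanishesAtOrigin f) :
    DifferentiableOn ℂ (dslope f 0) unitDisk :=
  (differentiableOn_dslope (isOpen_unitDisk.mem_nhds zero_mem_unitDisk)).2 hf.differentiableOn

lemma eq_mul_dslope (hf : OmitsOneVanishesAtOrigin f) (z : ℂ) : f z = z * dslope f 0 z := by
  simpa [hf.map_zero] using (sub_smul_dslope f 0 z).symm

lemma norm_deriv_le (hf : OmitsOneVanishesAtOrigin f) : ‖deriv f 0‖ ≤ 16 := by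
  by_cases hd : deriv f 0 = 0
  · simp [hd]
  have hd' : 0 < ‖deriv f 0‖ := norm_pos_iff.2 hd
  by_contra! hlt
  obtain ⟨r, hr, hr1⟩ := exists_between ((div_lt_one hd').2 hlt)
  have hr0 : 0 < r := lt_trans (by positivity) hr
  have havg : Real.circleAverage (fun z ↦ Real.log ‖f z‖) 0 r =
      Real.log r + Real.log ‖deriv f 0‖ := by
    have hp := hf.differentiableOn_dslope_zero
    have hp0 := hf.dslope_ne_zero hd
    have hcp : ContinuousOn (fun z ↦ Real.log ‖dslope f 0 z‖) (sphere 0 |r|) :=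
      (hp.continuousOn.mono fun _ hz ↦ (sphere_subset hr0 hr1 hz).1).norm.log
        fun z hz ↦ norm_ne_zero_iff.2 (hp0 z (sphere_subset hr0 hr1 hz).1)
    rw [← dslope_same f 0, ← circleAverage_log_norm_of_ne_zero hp hp0 hr0 hr1,
      ← Real.circleAverage_const (Real.log r) 0 r,
      ← Real.circleAverage_add continuousOn_const.circleIntegrable' hcp.circleIntegrable']
    refine Real.circleAverage_congr_sphere fun z hz ↦ ?_
    have hzr : ‖z‖ = r := by rwa [mem_sphere_zero_iff_norm, abs_of_pos hr0] at hz
    obtain ⟨hz, hz0⟩ := sphere_subset hr0 hr1 hz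
    simp only [Pi.add_apply]
    rw [hf.eq_mul_dslope z, norm_mul, hzr,
      Real.log_mul hr0.ne' (norm_ne_zero_iff.2 (hp0 z hz))]
  have h := hf.circleAverage_log_norm_le hr0 hr1
  have h16 : 4 * Real.log 2 = Real.log 16 := by
    rw [show (16 : ℝ) = 2 ^ 4 by norm_num, Real.log_pow]
    norm_num
  rw [havg, ← Real.log_mul hr0.ne' hd'.ne', h16,
    Real.log_le_log_iff (by positivity) (by norm_num)] at h
  rw [div_lt_iff₀ hd'] at hr
  linarith

/-- The inverse Landen-type transformation, which improves the derivative at the origin. -/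
lemma exists_norm_deriv_eq (hf : OmitsOneVanishesAtOrigin f) (hd : deriv f 0 ≠ 0) :
    ∃ f₁, OmitsOneVanishesAtOrigin f₁ ∧ ‖deriv f₁ 0‖ = 4 * √‖deriv f 0‖ := by
  have hmap : MapsTo (fun z : ℂ ↦ z ^ 2) unitDisk unitDisk := by
    intro z hz
    rw [mem_unitDisk_iff] at hz ⊢
    rw [norm_pow]
    exact pow_lt_one₀ (norm_nonneg _) hz two_ne_zero
  obtain ⟨s, hs⟩ := IsAlgClosed.exists_pow_nat_eq (deriv f 0) two_pos
  obtain ⟨q, hqd, hq0, hq⟩ := exists_differentiableOn_sq_eq (g := fun z ↦ dslope f 0 (z ^ 2))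
    (s := s) (hf.differentiableOn_dslope_zero.comp (by fun_prop) hmap)
    (fun z hz ↦ hf.dslope_ne_zero hd _ (hmap hz)) (by simp [hs])
  have hF2 : ∀ z ∈ unitDisk, (z * q z) ^ 2 = f (z ^ 2) := by
    intro z hz
    rw [mul_pow, hq z hz, hf.eq_mul_dslope]
  have hne1 : ∀ z ∈ unitDisk, 1 - z * q z ≠ 0 := by
    intro z hz h
    refine hf.ne_one _ (hmap hz) ?_
    rw [← hF2 z hz, ← sub_eq_zero.1 h, one_pow]
  have hFd : DifferentiableOn ℂ (fun z ↦ z * q z) unitDisk := differentiableOn_id.mul hqd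
  refine ⟨fun z ↦ z * q z * (-4 / (1 - z * q z) ^ 2), ⟨?_, by simp, ?_, ?_⟩, ?_⟩
  · exact hFd.mul ((differentiableOn_const _).div ((hFd.const_sub 1).pow 2)
      fun z hz ↦ pow_ne_zero 2 (hne1 z hz))
  · intro z hz h
    have h1 := hne1 z hz
    refine hf.ne_one _ (hmap hz) ?_
    rw [← hF2 z hz]
    field_simp at h
    have h2 : (z * q z + 1) ^ 2 = 0 := by linear_combination -h
    have h3 : z * q z + 1 = 0 := by simpa using h2
    linear_combination (z * q z - 1) * h3
  · intro z hz hz0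
    have h2 : (z * q z) ^ 2 ≠ 0 := by
      rw [hF2 z hz]
      exact hf.ne_zero _ (hmap hz) (pow_ne_zero 2 hz0)
    exact mul_ne_zero (fun h ↦ h2 (by simp [h]))
      (div_ne_zero (by norm_num) (pow_ne_zero 2 (hne1 z hz)))
  · have hnhds := isOpen_unitDisk.mem_nhds zero_mem_unitDisk
    have h1 := (hasDerivAt_id (0 : ℂ)).mul (hqd.differentiableAt hnhds).hasDerivAt
    have h2 : DifferentiableAt ℂ (fun z ↦ -4 / (1 - z * q z) ^ 2) 0 :=
      ((differentiableOn_const _).div ((hFd.const_sub 1).pow 2)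
        fun z hz ↦ pow_ne_zero 2 (hne1 z hz)).differentiableAt hnhds
    have h3 : HasDerivAt (fun z ↦ z * q z * (-4 / (1 - z * q z) ^ 2)) (s * -4) 0 :=
      (h1.mul h2.hasDerivAt).congr_deriv (by simp [hq0])
    rw [h3.deriv, ← hs, norm_mul, norm_pow, Real.sqrt_sq (norm_nonneg _)]
    norm_num
    ring

/-- The sharp constant for the derivative at the origin of a holomorphic function omitting `1`
and vanishing only at the origin. -/
lemma isLUB_norm_deriv :
    IsLUB {a : ℝ | 0 < a ∧ ∃ f, OmitsOneVanishesAtOrigin f ∧ ‖deriv f 0‖ = a} 16 := by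
  set S := {a : ℝ | 0 < a ∧ ∃ f, OmitsOneVanishesAtOrigin f ∧ ‖deriv f 0‖ = a} with hS
  have hub : 16 ∈ upperBounds S := by
    rintro a ⟨-, f, hf, rfl⟩
    exact hf.norm_deriv_le
  have h1 : (1 : ℝ) ∈ S := by
    refine ⟨one_pos, id, ⟨differentiableOn_id, rfl, fun z hz h ↦ ?_, fun z _ h ↦ h⟩, by simp⟩
    rw [mem_unitDisk_iff, show z = 1 from h] at hz
    simp at hz
  have hlub := isLUB_csSup ⟨1, h1⟩ ⟨16, hub⟩
  have hA1 : 1 ≤ sSup S := hlub.1 h1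
  have hle : sSup S ≤ sSup S ^ 2 / 16 := by
    refine hlub.2 ?_
    rintro a ⟨ha, f, hf, hfa⟩
    obtain ⟨f₁, hf₁, h⟩ := hf.exists_norm_deriv_eq (norm_pos_iff.1 (hfa ▸ ha))
    rw [hfa] at h
    have h4 : 4 * √a ≤ sSup S := hlub.1 ⟨by positivity, f₁, hf₁, h⟩
    have h5 := Real.sq_sqrt ha.le
    nlinarith [Real.sqrt_nonneg a]
  have h16 : sSup S = 16 := le_antisymm (hlub.2 hub) (by nlinarith)
  rwa [h16] at hlub

end OmitsOneVanishesAtOrigin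

lemma hurwitzRadius_compl_zero {w : ℂ} (hw : w ≠ 0) :
    hurwitzRadius {(0 : ℂ)}ᶜ w = 16 * ‖w‖ := by
  have hw' : 0 < ‖w‖ := norm_pos_iff.2 hw
  have hnhds := isOpen_unitDisk.mem_nhds zero_mem_unitDisk
  have hlub := OmitsOneVanishesAtOrigin.isLUB_norm_deriv
  have hmem : ∀ a ∈ {a : ℝ | 0 < a ∧ ∃ f, OmitsOneVanishesAtOrigin f ∧ ‖deriv f 0‖ = a},
      a * ‖w‖ ∈ { r : ℝ | 0 < r ∧ ∃ h : ℂ → ℂ, DifferentiableOn ℂ h unitDisk ∧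
        Set.MapsTo h unitDisk {(0 : ℂ)}ᶜ ∧ h 0 = w ∧ (∀ t ∈ unitDisk, t ≠ 0 → h t ≠ w) ∧
        deriv h 0 = (r : ℂ) } := by
    rintro a ⟨ha, f, hf, hfa⟩
    have hd0 : deriv f 0 ≠ 0 := norm_pos_iff.1 (hfa ▸ ha)
    obtain ⟨c, hc⟩ : ∃ c : ℂ, c = -(a * ‖w‖ : ℝ) / (w * deriv f 0) := ⟨_, rfl⟩
    have hc1 : ‖c‖ = 1 := by
      rw [hc, norm_div, norm_neg, norm_real, Real.norm_of_nonneg (by positivity), norm_mul, hfa,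
        mul_comm]
      exact div_self (by positivity)
    have hc0 : c ≠ 0 := norm_pos_iff.1 (hc1 ▸ one_pos)
    have hmap : MapsTo (fun z ↦ c * z) unitDisk unitDisk := by
      intro z hz
      rw [mem_unitDisk_iff] at hz ⊢
      rwa [norm_mul, hc1, one_mul]
    refine ⟨by positivity, fun z ↦ w * (1 - f (c * z)), ?_, ?_, ?_, ?_, ?_⟩
    · exact ((hf.differentiableOn.comp (by fun_prop) hmap).const_sub 1).const_mul w
    · intro z hz
      exact mul_ne_zero hw (sub_ne_zero.2 (hf.ne_one _ (hmap hz)).symm)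
    · simp [hf.map_zero]
    · intro z hz hz0 h
      refine hf.ne_zero _ (hmap hz) (mul_ne_zero hc0 hz0) ?_
      have := mul_left_cancel₀ hw (h.trans (mul_one w).symm)
      linear_combination -this
    · have h1 : HasDerivAt f (deriv f 0) (c * 0) := by
        rw [mul_zero]
        exact (hf.differentiableOn.differentiableAt hnhds).hasDerivAt
      have h2 := ((h1.comp 0 ((hasDerivAt_id (0 : ℂ)).const_mul c)).const_sub 1).const_mul w
      refine h2.deriv.trans ?_
      rw [hc]
      field_simp
  obtain ⟨a, ha⟩ := hlub.nonempty
  refine IsLUB.csSup_eq ⟨?_, fun b hb ↦ ?_⟩ ⟨_, hmem a ha⟩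
  · rintro r ⟨hr, h, hd, hmaps, h0, hne, hder⟩
    have hf : OmitsOneVanishesAtOrigin (fun z ↦ 1 - h z / w) := by
      refine ⟨(hd.div_const w).const_sub 1, by simp [h0, hw], fun z hz hz1 ↦ ?_,
        fun z hz hz0 hz1 ↦ ?_⟩
      · have : h z / w = 0 := by linear_combination -hz1
        exact hmaps hz (by simpa [hw] using this)
      · exact hne z hz hz0 ((div_eq_one_iff_eq hw).1 (sub_eq_zero.1 hz1).symm)
    have := hf.norm_deriv_le
    rw [deriv_const_sub, deriv_div_const, hder, norm_neg, norm_div, norm_real,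
      Real.norm_of_nonneg hr.le, div_le_iff₀ hw'] at this
    exact this
  · rw [← le_div_iff₀ hw']
    exact hlub.2 fun a ha ↦ (le_div_iff₀ hw').2 (hb (hmem a ha))

/-- the Hurwitz density of the punctured plane is `1/(8|w|)`. -/
theorem hurwitz_density_punctured_plane (w : ℂ) (hw : w ≠ 0) :
    hurwitzDensity {(0 : ℂ)}ᶜ w = 1 / (8 * ‖w‖) := by
  rw [hurwitzDensity, hurwitzRadius_compl_zero hw]
  field_simp
  norm_num
end
end

section
/- Let Ω and Y be proper subdomains of ℂ and let h : Ω → Y be an injective holomorphic function. Then η_Y(h(w₁), h(w₂)) ≤ η_Ω(w₁, w₂) for all w₁, w₂ ∈ Ω, where the left side is the Hurwitz distance in Y between h(w₁) and h(w₂). Moreover, equality holds for all w₁, w₂ if h is a conformal homeomorphism of Ω onto Y. -/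
open Complex Set Metric
open scoped ENNReal

noncomputable section

/-- A weak form of **Bloch's theorem**: the image of the unit disk under a holomorphic map `q`
contains a disk whose radius is proportional to `‖q' 0‖`. -/
lemma exists_ball_subset_image_of_differentiableOn {q : ℂ → ℂ}
    (hq : DifferentiableOn ℂ q (ball 0 1)) :
    ∃ a, ball a (‖deriv q 0‖ / 96) ⊆ q '' ball 0 1 := by
  rcases eq_or_ne (deriv q 0) 0 with h0 | h0
  · exact ⟨0, by simp [h0]⟩
  have hq' : DifferentiableOn ℂ (deriv q) (ball 0 1) := hq.deriv isOpen_ball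
  have hsub : closedBall (0 : ℂ) (1 / 2) ⊆ ball 0 1 := closedBall_subset_ball (by norm_num)
  obtain ⟨z₀, hz₀, hmax⟩ := (isCompact_closedBall (0 : ℂ) (1 / 2)).exists_isMaxOn
    (nonempty_closedBall.2 (by norm_num))
    (f := fun z ↦ ‖deriv q z‖ * (1 / 2 - ‖z‖))
    ((hq'.continuousOn.mono hsub).norm.mul (by fun_prop))
  have hmax' : ∀ z, ‖z‖ ≤ 1 / 2 →
      ‖deriv q z‖ * (1 / 2 - ‖z‖) ≤ ‖deriv q z₀‖ * (1 / 2 - ‖z₀‖) := fun z hz ↦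
    hmax (by simpa using hz)
  have hz₀' : ‖z₀‖ ≤ 1 / 2 := by simpa using hz₀
  have hz₀0 := hmax' 0 (by simp)
  have hpos0 : 0 < ‖deriv q 0‖ := norm_pos_iff.2 h0
  set M := ‖deriv q z₀‖ with hM
  have hMn : 0 ≤ M := norm_nonneg _
  obtain ⟨ρ, hρ⟩ : ∃ ρ, ρ = (1 / 2 - ‖z₀‖) / 2 := ⟨_, rfl⟩
  have hρ0 : 0 < ρ := by
    by_contra! hcon
    have : ρ = 0 := by linarith
    have h2 : 1 / 2 - ‖z₀‖ = 0 := by linarith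
    rw [h2, norm_zero, mul_zero] at hz₀0
    linarith
  have hMpos : 0 < M := by
    by_contra! hcon
    have : M = 0 := le_antisymm hcon hMn
    rw [this, norm_zero, zero_mul] at hz₀0
    linarith
  have hballnorm : ∀ z ∈ ball z₀ ρ, ‖z‖ ≤ ‖z₀‖ + ρ := by
    intro z hz
    rw [mem_ball, dist_eq_norm] at hz
    have := norm_add_le z₀ (z - z₀)
    rw [add_sub_cancel] at this
    linarith
  have hball : ball z₀ ρ ⊆ ball 0 1 := by
    intro z hz
    have := hballnorm z hz
    rw [mem_ball_zero_iff]
    linarith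
  have hbound : ∀ z ∈ ball z₀ ρ, ‖deriv q z‖ ≤ 2 * M := by
    intro z hz
    have h1 := hballnorm z hz
    have h2 := hmax' z (by linarith)
    have h3 : ‖deriv q z‖ * ρ ≤ ‖deriv q z‖ * (1 / 2 - ‖z‖) := by
      gcongr
      linarith
    have h4 : ‖deriv q z‖ * ρ ≤ (2 * M) * ρ := by
      calc _ ≤ _ := h3
        _ ≤ _ := h2
        _ = _ := by rw [hρ]; ring
    exact le_of_mul_le_mul_right h4 hρ0
  have hschwarz : ∀ z ∈ ball z₀ ρ, dist (deriv q z) (deriv q z₀) ≤ 3 * M / ρ * dist z z₀ := by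
    intro z hz
    refine dist_le_div_mul_dist_of_mapsTo_ball (hq'.mono hball) (fun w hw ↦ ?_) hz
    rw [mem_closedBall, dist_eq_norm]
    calc _ ≤ ‖deriv q w‖ + ‖deriv q z₀‖ := norm_sub_le _ _
      _ ≤ _ := by linarith [hbound w hw]
  have hs0 : 0 < ρ / 6 := by positivity
  have hsball : closedBall z₀ (ρ / 6) ⊆ ball z₀ ρ := closedBall_subset_ball (by linarith)
  have hat : ∀ z ∈ ball z₀ ρ, DifferentiableAt ℂ q z := fun z hz ↦
    hq.differentiableAt (isOpen_ball.mem_nhds (hball hz))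
  have hlow : ∀ z ∈ sphere z₀ (ρ / 6), M * ρ / 12 ≤ ‖q z - q z₀‖ := by
    intro z hz
    have hz' : ‖z - z₀‖ = ρ / 6 := by simpa [dist_eq_norm] using hz
    have h1 : ‖(q z - deriv q z₀ * z) - (q z₀ - deriv q z₀ * z₀)‖ ≤ M / 2 * ‖z - z₀‖ := by
      refine (convex_closedBall z₀ (ρ / 6)).norm_image_sub_le_of_norm_hasDerivWithin_le
        (f := fun z ↦ q z - deriv q z₀ * z) (f' := fun z ↦ deriv q z - deriv q z₀)
        (fun w hw ↦ ?_) (fun w hw ↦ ?_) (mem_closedBall_self hs0.le) (sphere_subset_closedBall hz)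
      · have := (hat w (hsball hw)).hasDerivAt.sub ((hasDerivAt_id w).const_mul (deriv q z₀))
        rw [mul_one] at this
        exact this.hasDerivWithinAt
      · have h2 := hschwarz w (hsball hw)
        rw [dist_eq_norm] at h2
        refine h2.trans ?_
        calc 3 * M / ρ * dist w z₀ ≤ 3 * M / ρ * (ρ / 6) := by
              gcongr
              exact hw
          _ = M / 2 := by field_simp; norm_num
    have h3 : ‖deriv q z₀ * (z - z₀)‖ = M * (ρ / 6) := by rw [norm_mul, hz']
    have h4 : ‖deriv q z₀ * (z - z₀)‖ ≤ ‖q z - q z₀‖ +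
        ‖(q z - deriv q z₀ * z) - (q z₀ - deriv q z₀ * z₀)‖ := by
      rw [show deriv q z₀ * (z - z₀) = (q z - q z₀) -
        ((q z - deriv q z₀ * z) - (q z₀ - deriv q z₀ * z₀)) by ring]
      exact norm_sub_le _ _
    rw [hz'] at h1
    linarith
  have hfreq : ∃ᶠ z in nhds z₀, q z ≠ q z₀ := by
    intro hcon
    have : q =ᶠ[nhds z₀] fun _ ↦ q z₀ := by
      filter_upwards [hcon] with z hz using not_not.1 hz
    have h5 := this.deriv_eq
    rw [deriv_const] at h5
    rw [hM, h5, norm_zero] at hMpos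
    exact lt_irrefl _ hMpos
  have hdc : DiffContOnCl ℂ q (ball z₀ (ρ / 6)) :=
    (hq.mono (hsball.trans hball)).diffContOnCl_ball subset_rfl
  refine ⟨q z₀, (ball_subset_ball ?_).trans
    ((hdc.ball_subset_image_closedBall hs0 hlow hfreq).trans (image_mono (hsball.trans hball)))⟩
  rw [norm_zero, sub_zero] at hz₀0
  rw [show 1 / 2 - ‖z₀‖ = 2 * ρ by rw [hρ]; ring] at hz₀0
  linarith

/-- The points where `cos (π ω)` is a nonzero integer form a `2`-net in the plane. -/
lemma exists_cos_pi_mul_eq_intCast (z : ℂ) :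
    ∃ ω, dist ω z < 2 ∧ ∃ n : ℤ, n ≠ 0 ∧ Complex.cos (Real.pi * ω) = n := by
  obtain ⟨y, hy, hyd, n, hn, hcosh⟩ : ∃ y : ℝ, 0 ≤ y ∧ |y - abs z.im| < 1 ∧
      ∃ n : ℕ, n ≠ 0 ∧ Real.cosh (Real.pi * y) = n := by
    set Y := |z.im|
    have hY : 0 ≤ Y := abs_nonneg _
    set n := ⌊Real.cosh (Real.pi * Y)⌋₊
    have hn1 : 1 ≤ n := Nat.le_floor (by simp)
    have hn2 : (n : ℝ) ≤ Real.cosh (Real.pi * Y) := Nat.floor_le (Real.cosh_pos _).le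
    have hn3 : Real.cosh (Real.pi * Y) < n + 1 := Nat.lt_floor_add_one _
    have hn1' : (1 : ℝ) ≤ n := by exact_mod_cast hn1
    obtain ⟨y, ⟨hy0, hyY⟩, hy⟩ := intermediate_value_Icc hY
      (f := fun y ↦ Real.cosh (Real.pi * y)) (by fun_prop)
      (show (n : ℝ) ∈ _ by simpa using ⟨hn1, hn2⟩)
    refine ⟨y, hy0, ?_, n, by omega, hy⟩
    rw [abs_sub_comm, abs_of_nonneg (by linarith)]
    by_contra! hcon
    have hy' : Real.cosh (Real.pi * y) = n := hy
    have h1 : Real.cosh (Real.pi * y) ≤ Real.exp (Real.pi * y) := by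
      rw [Real.cosh_eq]
      have : Real.exp (-(Real.pi * y)) ≤ Real.exp (Real.pi * y) :=
        Real.exp_le_exp.2 (by nlinarith [Real.pi_pos])
      linarith
    have h2 : Real.exp (Real.pi * Y) / 2 ≤ Real.cosh (Real.pi * Y) := by
      rw [Real.cosh_eq]
      have := Real.exp_pos (-(Real.pi * Y))
      linarith
    have h3 : Real.exp (Real.pi * y) * Real.exp Real.pi ≤ Real.exp (Real.pi * Y) := by
      rw [← Real.exp_add]
      exact Real.exp_le_exp.2 (by nlinarith [Real.pi_pos])
    have h4 : 4 ≤ Real.exp Real.pi := by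
      linarith [Real.add_one_le_exp Real.pi, Real.pi_gt_three]
    have h5 := Real.exp_pos (Real.pi * y)
    nlinarith
  obtain ⟨s, hs, hsz⟩ : ∃ s : ℝ, (s = 1 ∨ s = -1) ∧ z.im = s * |z.im| := by
    rcases le_total 0 z.im with h | h
    · exact ⟨1, Or.inl rfl, by rw [abs_of_nonneg h, one_mul]⟩
    · exact ⟨-1, Or.inr rfl, by rw [abs_of_nonpos h]; ring⟩
  set m := round z.re
  have hm : |z.re - m| ≤ 1 / 2 := abs_sub_round _
  refine ⟨m + (s * y : ℝ) * I, ?_, ?_⟩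
  · rw [dist_eq_norm]
    have hdiff : (m + (s * y : ℝ) * I : ℂ) - z =
        -((z.re - m : ℝ) : ℂ) + ((s * (y - |z.im|) : ℝ) : ℂ) * I := by
      conv_lhs => rw [← re_add_im z, hsz]
      push_cast
      ring
    rw [hdiff]
    refine (norm_add_le _ _).trans_lt ?_
    have hsa : |s| = 1 := by rcases hs with rfl | rfl <;> simp
    rw [norm_neg, norm_mul, norm_I, mul_one, norm_real, norm_real, Real.norm_eq_abs,
      Real.norm_eq_abs, abs_mul, hsa]
    linarith
  · have hc : Complex.cos (Real.pi * y * I) = n := by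
      rw [Complex.cos_mul_I]
      exact_mod_cast congrArg ((↑) : ℝ → ℂ) hcosh
    have hc' : Complex.cos (Real.pi * ((s * y : ℝ) * I)) = n := by
      rcases hs with rfl | rfl
      · rw [← hc]; congr 1; push_cast; ring
      · rw [← hc, ← Complex.cos_neg]; congr 1; push_cast; ring
    rcases Int.even_or_odd' m with ⟨k, hk | hk⟩
    · refine ⟨n, by exact_mod_cast hn, ?_⟩
      rw [Int.cast_natCast, ← hc',
        ← Complex.cos_add_int_mul_two_pi (Real.pi * ((s * y : ℝ) * I)) k, hk]
      congr 1
      push_cast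
      ring
    · refine ⟨-n, by simpa using hn, ?_⟩
      rw [Int.cast_neg, Int.cast_natCast, ← hc', ← Complex.cos_add_pi,
        ← Complex.cos_add_int_mul_two_pi (Real.pi * ((s * y : ℝ) * I) + Real.pi) k, hk]
      congr 1
      push_cast
      ring

/-- A nowhere vanishing holomorphic function on the unit disk has a holomorphic logarithm. -/
lemma exists_exp_eq_of_differentiableOn_ball {f : ℂ → ℂ} (hf : DifferentiableOn ℂ f (ball 0 1))
    (h0 : ∀ z ∈ ball (0 : ℂ) 1, f z ≠ 0) {a : ℂ} (ha : Complex.exp a = f 0) :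
    ∃ L : ℂ → ℂ, DifferentiableOn ℂ L (ball 0 1) ∧ L 0 = a ∧
      ∀ z ∈ ball (0 : ℂ) 1, Complex.exp (L z) = f z := by
  obtain ⟨L, hL0, hL⟩ :=
    (((hf.deriv isOpen_ball).div hf h0).isExactOn_ball).with_val_at 0 a
  have hmem : (0 : ℂ) ∈ ball (0 : ℂ) 1 := mem_ball_self one_pos
  refine ⟨L, fun z hz ↦ (hL z hz).differentiableAt.differentiableWithinAt, hL0, ?_⟩
  have hder : ∀ z ∈ ball (0 : ℂ) 1, HasDerivAt (fun z ↦ Complex.exp (-L z) * f z) 0 z := by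
    intro z hz
    have h1 := (hL z hz).neg.cexp.mul (hf.differentiableAt (isOpen_ball.mem_nhds hz)).hasDerivAt
    refine h1.congr_deriv ?_
    have := h0 z hz
    change Complex.exp (-L z) * -(deriv f z / f z) * f z + Complex.exp (-L z) * deriv f z = 0
    field_simp
    ring
  intro z hz
  have hconst := isOpen_ball.is_const_of_deriv_eq_zero (convex_ball (0 : ℂ) 1).isPreconnected
    (fun z hz ↦ (hder z hz).differentiableAt.differentiableWithinAt)
    (fun z hz ↦ (hder z hz).deriv) hz hmem
  simp only [hL0, ← ha, ← Complex.exp_add, neg_add_cancel, Complex.exp_zero] at hconst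
  rw [Complex.exp_neg] at hconst
  field_simp [Complex.exp_ne_zero] at hconst
  exact hconst.symm

/-- A holomorphic function on the unit disk omitting `1` and `-1` is the cosine of a holomorphic
function. -/
lemma exists_cos_pi_mul_eq_of_differentiableOn_ball {p : ℂ → ℂ}
    (hp : DifferentiableOn ℂ p (ball 0 1)) (h1 : ∀ z ∈ ball (0 : ℂ) 1, p z ≠ 1)
    (h2 : ∀ z ∈ ball (0 : ℂ) 1, p z ≠ -1) :
    ∃ q : ℂ → ℂ, DifferentiableOn ℂ q (ball 0 1) ∧
      ∀ z ∈ ball (0 : ℂ) 1, p z = Complex.cos (Real.pi * q z) := by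
  have hne : ∀ z ∈ ball (0 : ℂ) 1, 1 - p z ^ 2 ≠ 0 := by
    intro z hz h
    have : (1 - p z) * (1 + p z) = 0 := by rw [← h]; ring
    rcases mul_eq_zero.1 this with h | h
    · exact h1 z hz (by linear_combination -h)
    · exact h2 z hz (by linear_combination h)
  have hmem : (0 : ℂ) ∈ ball (0 : ℂ) 1 := mem_ball_self one_pos
  obtain ⟨L, hL, -, hLe⟩ := exists_exp_eq_of_differentiableOn_ball
    (f := fun z ↦ 1 - p z ^ 2) ((hp.pow 2).const_sub 1) hne (Complex.exp_log (hne 0 hmem))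
  set s : ℂ → ℂ := fun z ↦ Complex.exp (L z / 2)
  have hs : ∀ z ∈ ball (0 : ℂ) 1, s z ^ 2 = 1 - p z ^ 2 := by
    intro z hz
    rw [← hLe z hz, ← Complex.exp_nat_mul]
    congr 1
    push_cast
    ring
  have hsd : DifferentiableOn ℂ s (ball 0 1) := (hL.div_const 2).cexp
  have hmul : ∀ z ∈ ball (0 : ℂ) 1, (p z + I * s z) * (p z - I * s z) = 1 := by
    intro z hz
    linear_combination hs z hz - s z ^ 2 * I_sq
  have hne' : ∀ z ∈ ball (0 : ℂ) 1, p z + I * s z ≠ 0 := fun z hz h ↦ by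
    have := hmul z hz
    rw [h, zero_mul] at this
    exact zero_ne_one this
  obtain ⟨F, hF, -, hFe⟩ := exists_exp_eq_of_differentiableOn_ball
    (f := fun z ↦ p z + I * s z) (hp.add (hsd.const_mul I)) hne' (Complex.exp_log (hne' 0 hmem))
  refine ⟨fun z ↦ F z / (Real.pi * I), hF.div_const _, fun z hz ↦ ?_⟩
  have hpi : (Real.pi : ℂ) ≠ 0 := by exact_mod_cast Real.pi_ne_zero
  rw [Complex.cos, show (Real.pi : ℂ) * (F z / (Real.pi * I)) * I = F z by field_simp,
    show -((Real.pi : ℂ) * (F z / (Real.pi * I))) * I = -F z by field_simp, Complex.exp_neg,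
    hFe z hz, inv_eq_of_mul_eq_one_right (hmul z hz)]
  ring

/-- A holomorphic function on the unit disk which omits `1` and vanishes only at the origin has
derivative at the origin bounded by an absolute constant. -/
lemma norm_deriv_zero_le_of_eq_zero_iff {g : ℂ → ℂ} (hg : DifferentiableOn ℂ g (ball 0 1))
    (hg0 : g 0 = 0) (hgne : ∀ z ∈ ball (0 : ℂ) 1, z ≠ 0 → g z ≠ 0)
    (hg1 : ∀ z ∈ ball (0 : ℂ) 1, g z ≠ 1) :
    ‖deriv g 0‖ ≤ 384 * Real.pi ^ 2 := by
  have hmem : (0 : ℂ) ∈ ball (0 : ℂ) 1 := mem_ball_self one_pos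
  have hpi : (Real.pi : ℂ) ≠ 0 := by exact_mod_cast Real.pi_ne_zero
  obtain ⟨v, hv, hv0, hve⟩ := exists_exp_eq_of_differentiableOn_ball
    (f := fun z ↦ 1 - g z) (a := 0) (hg.const_sub 1)
    (fun z hz ↦ sub_ne_zero.2 (hg1 z hz).symm) (by simp [hg0])
  set p : ℂ → ℂ := fun z ↦ v z / (2 * Real.pi * I)
  have hp : DifferentiableOn ℂ p (ball 0 1) := hv.div_const _
  have hvp : ∀ z, v z = p z * (2 * Real.pi * I) := fun z ↦ by
    simp only [p]; field_simp
  have hp0 : p 0 = 0 := by simp [p, hv0]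
  have homit : ∀ z ∈ ball (0 : ℂ) 1, ∀ n : ℤ, n ≠ 0 → p z ≠ n := by
    intro z hz n hn hpn
    have h1 : Complex.exp (v z) = 1 := by
      rw [hvp, hpn, Complex.exp_int_mul_two_pi_mul_I]
    have h2 : g z = 0 := by linear_combination hve z hz - h1
    have h3 : z = 0 := by
      by_contra h
      exact hgne z hz h h2
    rw [h3, hp0] at hpn
    exact hn (by exact_mod_cast hpn.symm)
  obtain ⟨q, hq, hqp⟩ := exists_cos_pi_mul_eq_of_differentiableOn_ball hp
    (fun z hz ↦ by simpa using homit z hz 1 one_ne_zero)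
    (fun z hz ↦ by simpa using homit z hz (-1) (by norm_num))
  have hqb : ‖deriv q 0‖ ≤ 192 := by
    by_contra! hcon
    obtain ⟨a, ha⟩ := exists_ball_subset_image_of_differentiableOn hq
    obtain ⟨ω, hω, n, hn, hcos⟩ := exists_cos_pi_mul_eq_intCast a
    obtain ⟨z, hz, rfl⟩ := ha (show ω ∈ _ from hω.trans (by linarith))
    exact homit z hz n hn ((hqp z hz).trans hcos)
  have hnhds : ball (0 : ℂ) 1 ∈ nhds (0 : ℂ) := isOpen_ball.mem_nhds hmem
  have hpd : HasDerivAt p (-Complex.sin (Real.pi * q 0) * (Real.pi * deriv q 0)) 0 := by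
    have h1 := ((hq.differentiableAt hnhds).hasDerivAt.const_mul (Real.pi : ℂ)).ccos
    refine h1.congr_of_eventuallyEq ?_
    filter_upwards [hnhds] with z hz using hqp z hz
  have hgd : HasDerivAt g (-(deriv p 0 * (2 * Real.pi * I))) 0 := by
    have h1 := ((hpd.differentiableAt.hasDerivAt.mul_const (2 * Real.pi * I)).cexp).const_sub 1
    simp only [hp0, zero_mul, Complex.exp_zero, one_mul] at h1
    refine h1.congr_of_eventuallyEq ?_
    filter_upwards [hnhds] with z hz
    rw [← hvp, hve z hz]
    ring
  have hcos0 : Complex.cos (Real.pi * q 0) = 0 := by rw [← hqp 0 hmem, hp0]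
  have hsin : ‖Complex.sin (Real.pi * q 0)‖ = 1 := by
    have h1 := Complex.sin_sq_add_cos_sq (Real.pi * q 0)
    rw [hcos0] at h1
    have h2 : ‖Complex.sin (Real.pi * q 0)‖ ^ 2 = 1 := by
      rw [← norm_pow]
      rw [show Complex.sin (Real.pi * q 0) ^ 2 = 1 by linear_combination h1, norm_one]
    exact (pow_eq_one_iff_of_nonneg (norm_nonneg _) two_ne_zero).1 h2
  rw [hgd.deriv, hpd.deriv]
  simp only [norm_neg, norm_mul, hsin, norm_real, norm_I, Real.norm_eq_abs,
    abs_of_pos Real.pi_pos, norm_ofNat]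
  nlinarith [mul_le_mul_of_nonneg_left hqb (sq_nonneg Real.pi)]

/-- The set of slopes `h' 0` whose supremum is the Hurwitz radius. -/
def hurwitzSlopes (Ω : Set ℂ) (w : ℂ) : Set ℝ :=
  { r : ℝ | 0 < r ∧ ∃ h : ℂ → ℂ, DifferentiableOn ℂ h unitDisk ∧
    Set.MapsTo h unitDisk Ω ∧ h 0 = w ∧ (∀ t ∈ unitDisk, t ≠ 0 → h t ≠ w) ∧
    deriv h 0 = (r : ℂ) }

lemma unitDisk_mem_nhds_zero : unitDisk ∈ nhds (0 : ℂ) := ball_mem_nhds _ one_pos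

lemma hurwitzRadius_nonneg (Ω : Set ℂ) (w : ℂ) : 0 ≤ hurwitzRadius Ω w :=
  Real.sSup_nonneg fun _ hr ↦ hr.1.le

lemma hurwitzDensity_nonneg (Ω : Set ℂ) (w : ℂ) : 0 ≤ hurwitzDensity Ω w :=
  div_nonneg zero_le_two (hurwitzRadius_nonneg Ω w)

lemma bddAbove_hurwitzSlopes {Ω : Set ℂ} (hΩ : Ω ≠ univ) {w : ℂ} (hw : w ∈ Ω) :
    BddAbove (hurwitzSlopes Ω w) := by
  obtain ⟨a, ha⟩ := (ne_univ_iff_exists_notMem Ω).1 hΩ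
  have haw : a - w ≠ 0 := sub_ne_zero.2 fun h ↦ ha (h ▸ hw)
  refine ⟨384 * Real.pi ^ 2 * ‖a - w‖, ?_⟩
  rintro r ⟨hr, f, hf, hfm, hf0, hfne, hfd⟩
  have hd : deriv (fun z ↦ (f z - w) / (a - w)) 0 = r / (a - w) := by
    have h1 := ((hf.differentiableAt unitDisk_mem_nhds_zero).hasDerivAt.sub_const w).div_const
      (a - w)
    rw [hfd] at h1
    exact h1.deriv
  have h1 := norm_deriv_zero_le_of_eq_zero_iff (g := fun z ↦ (f z - w) / (a - w))
    ((hf.sub_const w).div_const _) (by simp [hf0])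
    (fun z hz hz0 ↦ div_ne_zero (sub_ne_zero.2 (hfne z hz hz0)) haw)
    (fun z hz h ↦ ha (by
      have : f z = a := by linear_combination (div_eq_one_iff_eq haw).1 h
      exact this ▸ hfm hz))
  rw [hd, norm_div, norm_real, Real.norm_of_nonneg hr.le, div_le_iff₀ (norm_pos_iff.2 haw)] at h1
  exact h1

lemma le_hurwitzRadius {Ω : Set ℂ} (hΩ : Ω ≠ univ) {w : ℂ} (hw : w ∈ Ω) {r : ℝ}
    (hr : r ∈ hurwitzSlopes Ω w) : r ≤ hurwitzRadius Ω w :=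
  le_csSup (bddAbove_hurwitzSlopes hΩ hw) hr

lemma mem_hurwitzSlopes_of_ball_subset {Ω : Set ℂ} {w : ℂ} {δ : ℝ} (hδ : 0 < δ)
    (h : ball w δ ⊆ Ω) : δ ∈ hurwitzSlopes Ω w := by
  refine ⟨hδ, fun t ↦ w + δ * t, by fun_prop, fun t ht ↦ h ?_, by simp, fun t _ ht0 ↦ ?_, ?_⟩
  · have ht' : ‖t‖ < 1 := by simpa [unitDisk] using ht
    rw [mem_ball, dist_eq_norm, add_sub_cancel_left, norm_mul, norm_real,
      Real.norm_of_nonneg hδ.le]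
    nlinarith
  · simpa [hδ.ne'] using ht0
  · have h1 := ((hasDerivAt_id (0 : ℂ)).const_mul (δ : ℂ)).const_add w
    rw [mul_one] at h1
    exact h1.deriv

lemma nonempty_hurwitzSlopes {Ω : Set ℂ} (hΩ : IsOpen Ω) {w : ℂ} (hw : w ∈ Ω) :
    (hurwitzSlopes Ω w).Nonempty := by
  obtain ⟨δ, hδ, hb⟩ := Metric.isOpen_iff.1 hΩ w hw
  exact ⟨δ, mem_hurwitzSlopes_of_ball_subset hδ hb⟩

lemma hurwitzRadius_pos {Ω : Set ℂ} (hΩo : IsOpen Ω) (hΩ : Ω ≠ univ) {w : ℂ} (hw : w ∈ Ω) :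
    0 < hurwitzRadius Ω w := by
  obtain ⟨δ, hδ⟩ := nonempty_hurwitzSlopes hΩo hw
  exact hδ.1.trans_le (le_hurwitzRadius hΩ hw hδ)

/-- By precomposing with a rotation, the positivity of the derivative may be dropped from the
definition of the Hurwitz radius. -/
lemma norm_deriv_mem_hurwitzSlopes {Ω : Set ℂ} {w c : ℂ} {f : ℂ → ℂ}
    (hf : DifferentiableOn ℂ f unitDisk) (hfm : MapsTo f unitDisk Ω) (hf0 : f 0 = w)
    (hfne : ∀ t ∈ unitDisk, t ≠ 0 → f t ≠ w) (hfd : HasDerivAt f c 0) (hc : c ≠ 0) :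
    ‖c‖ ∈ hurwitzSlopes Ω w := by
  have hcn : (‖c‖ : ℂ) ≠ 0 := by simpa using hc
  set u : ℂ := ‖c‖ / c with hu_def
  have hu : ‖u‖ = 1 := by simp [u, hc]
  have hu0 : u ≠ 0 := div_ne_zero hcn hc
  have hmaps : MapsTo (fun t ↦ u * t) unitDisk unitDisk := fun t ht ↦ by
    simpa [unitDisk, hu] using ht
  refine ⟨norm_pos_iff.2 hc, fun t ↦ f (u * t), hf.comp (by fun_prop) hmaps, hfm.comp hmaps,
    by simpa using hf0, fun t ht ht0 ↦ hfne _ (hmaps ht) (mul_ne_zero hu0 ht0), ?_⟩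
  have h1 : HasDerivAt (fun t : ℂ ↦ u * t) u 0 := by
    simpa using (hasDerivAt_id (0 : ℂ)).const_mul u
  have h2 : HasDerivAt (fun t ↦ f (u * t)) (c * u) 0 :=
    HasDerivAt.comp (h₂ := f) 0 (by simpa using hfd) h1
  rw [h2.deriv, hu_def]
  field_simp

/-- Injective holomorphic maps contract the Hurwitz density. -/
lemma hurwitzDensity_mul_norm_deriv_le {Ω Y : Set ℂ} (hΩo : IsOpen Ω) (hΩ : Ω ≠ univ)
    (hYo : IsOpen Y) (hY : Y ≠ univ) {h : ℂ → ℂ} (hhol : DifferentiableOn ℂ h Ω)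
    (hmaps : MapsTo h Ω Y) (hinj : InjOn h Ω) {w : ℂ} (hw : w ∈ Ω) :
    hurwitzDensity Y (h w) * ‖deriv h w‖ ≤ hurwitzDensity Ω w := by
  rcases eq_or_ne (deriv h w) 0 with h0 | h0
  · simpa [h0] using hurwitzDensity_nonneg Ω w
  have hpos : 0 < ‖deriv h w‖ := norm_pos_iff.2 h0
  have hle : hurwitzRadius Ω w ≤ hurwitzRadius Y (h w) / ‖deriv h w‖ := by
    refine csSup_le (nonempty_hurwitzSlopes hΩo hw) ?_
    rintro r ⟨hr, f, hf, hfm, hf0, hfne, hfd⟩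
    rw [le_div_iff₀ hpos]
    have hmem : (0 : ℂ) ∈ unitDisk := mem_of_mem_nhds unitDisk_mem_nhds_zero
    have hd : HasDerivAt (h ∘ f) (deriv h w * r) 0 := by
      have h1 := (hf.differentiableAt unitDisk_mem_nhds_zero).hasDerivAt
      rw [hfd] at h1
      refine HasDerivAt.comp 0 ?_ h1
      rw [hf0]
      exact (hhol.differentiableAt (hΩo.mem_nhds hw)).hasDerivAt
    have h1 := norm_deriv_mem_hurwitzSlopes (Ω := Y) (w := h w) (hhol.comp hf hfm)
      (hmaps.comp hfm) (by simp [hf0])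
      (fun t ht ht0 heq ↦ hfne t ht ht0 (hinj (hfm ht) hw heq)) hd
      (mul_ne_zero h0 (by exact_mod_cast hr.ne'))
    rw [norm_mul, norm_real, Real.norm_of_nonneg hr.le, mul_comm] at h1
    exact le_hurwitzRadius hY (hmaps hw) h1
  have hΩr := hurwitzRadius_pos hΩo hΩ hw
  have hYr := hurwitzRadius_pos hYo hY (hmaps hw)
  rw [le_div_iff₀ hpos] at hle
  rw [hurwitzDensity, hurwitzDensity, div_mul_eq_mul_div, div_le_div_iff₀ hYr hΩr]
  linarith

/-- The Hurwitz radius is lower semicontinuous. -/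
lemma lowerSemicontinuousAt_hurwitzRadius {Ω : Set ℂ} (hΩo : IsOpen Ω) (hΩ : Ω ≠ univ) {w : ℂ}
    (hw : w ∈ Ω) : LowerSemicontinuousAt (hurwitzRadius Ω) w := by
  intro c hc
  obtain ⟨r, ⟨hr, f, hf, hfm, hf0, hfne, hfd⟩, hcr⟩ :=
    exists_lt_of_lt_csSup (nonempty_hurwitzSlopes hΩo hw) hc
  obtain ⟨ρ, hρ, hρ1⟩ := exists_between (max_lt ((div_lt_one hr).2 hcr) one_pos)
  obtain ⟨hcρ, hρ0⟩ := max_lt_iff.1 hρ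
  rw [div_lt_iff₀ hr] at hcρ
  have hsub : closedBall (0 : ℂ) ρ ⊆ unitDisk := closedBall_subset_ball hρ1
  obtain ⟨δ, hδ, hthick⟩ := ((isCompact_closedBall (0 : ℂ) ρ).image_of_continuousOn
    (hf.continuousOn.mono hsub)).exists_thickening_subset_open hΩo
    ((image_mono hsub).trans hfm.image_subset)
  have hmaps : MapsTo (fun t : ℂ ↦ ρ * t) unitDisk (closedBall 0 ρ) := fun t ht ↦ by
    have ht' : ‖t‖ < 1 := by simpa [unitDisk] using ht
    rw [mem_closedBall_zero_iff, norm_mul, norm_real, Real.norm_of_nonneg hρ0.le]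
    nlinarith
  have hρc : (ρ : ℂ) ≠ 0 := by exact_mod_cast hρ0.ne'
  filter_upwards [hΩo.mem_nhds hw, ball_mem_nhds w hδ] with w' hw' hww'
  refine hcρ.trans_le (le_hurwitzRadius hΩ hw' ⟨mul_pos hρ0 hr, fun t ↦ f (ρ * t) + (w' - w),
    (hf.comp (by fun_prop) (hmaps.mono_right hsub)).add_const _, fun t ht ↦ hthick ?_,
    by simp [hf0], fun t ht ht0 heq ↦ hfne _ (hsub (hmaps ht)) (mul_ne_zero hρc ht0) ?_, ?_⟩)
  · rw [mem_thickening_iff]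
    exact ⟨_, mem_image_of_mem f (hmaps ht), by simpa [dist_eq_norm] using hww'⟩
  · linear_combination heq
  · have h1 : HasDerivAt (fun t : ℂ ↦ ρ * t) ρ 0 := by
      simpa using (hasDerivAt_id (0 : ℂ)).const_mul (ρ : ℂ)
    have h2 := (hf.differentiableAt unitDisk_mem_nhds_zero).hasDerivAt
    rw [hfd] at h2
    have h3 : HasDerivAt (fun t ↦ f (ρ * t)) (r * ρ) 0 :=
      HasDerivAt.comp (h₂ := f) 0 (by simpa using h2) h1
    rw [(h3.add_const _).deriv]
    push_cast
    ring

/-- The Hurwitz length element along a path is integrable. -/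
lemma IsPathIn.intervalIntegrable {Ω : Set ℂ} (hΩo : IsOpen Ω) (hΩ : Ω ≠ univ) {w₁ w₂ : ℂ}
    {γ : ℝ → ℂ} (hγ : IsPathIn Ω w₁ w₂ γ) :
    IntervalIntegrable
      (fun t ↦ hurwitzDensity Ω (γ t) * ‖derivWithin γ (Icc (0 : ℝ) 1) t‖)
      MeasureTheory.volume 0 1 := by
  obtain ⟨-, -, hγΩ, hγd⟩ := hγ
  have hcont := hγd.continuousOn
  have hext : Continuous fun t ↦ γ (projIcc (0 : ℝ) 1 zero_le_one t) :=
    hcont.comp_continuous (continuous_subtype_val.comp continuous_projIcc) fun t ↦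
      (projIcc (0 : ℝ) 1 zero_le_one t).2
  have hmeas : Measurable fun t ↦ hurwitzDensity Ω (γ (projIcc (0 : ℝ) 1 zero_le_one t)) := by
    have hlsc : LowerSemicontinuous fun t ↦
        hurwitzRadius Ω (γ (projIcc (0 : ℝ) 1 zero_le_one t)) :=
      fun t c hc ↦ hext.continuousAt.eventually
        (lowerSemicontinuousAt_hurwitzRadius hΩo hΩ (hγΩ _ (projIcc _ _ _ t).2) c hc)
    exact hlsc.measurable.const_div 2
  obtain ⟨δ, hδ, hthick⟩ := (isCompact_Icc.image_of_continuousOn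
    hcont).exists_thickening_subset_open hΩo (image_subset_iff.2 hγΩ)
  have hbound : ∀ t ∈ Icc (0 : ℝ) 1, ‖hurwitzDensity Ω (γ t)‖ ≤ 2 / δ := by
    intro t ht
    rw [Real.norm_of_nonneg (hurwitzDensity_nonneg _ _)]
    refine div_le_div_of_nonneg_left zero_le_two hδ (le_hurwitzRadius hΩ (hγΩ t ht)
      (mem_hurwitzSlopes_of_ball_subset hδ
        ((ball_subset_thickening (mem_image_of_mem γ ht) δ).trans hthick)))
  rw [intervalIntegrable_iff_integrableOn_Icc_of_le zero_le_one]
  have hder : MeasureTheory.IntegrableOn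
      (fun t ↦ ‖derivWithin γ (Icc (0 : ℝ) 1) t‖) (Icc 0 1) :=
    (hγd.continuousOn_derivWithin (uniqueDiffOn_Icc_zero_one) le_rfl).norm.integrableOn_Icc
  refine MeasureTheory.Integrable.bdd_mul (c := 2 / δ) hder ?_ ?_
  · refine hmeas.aestronglyMeasurable.congr ?_
    filter_upwards [MeasureTheory.ae_restrict_mem measurableSet_Icc] with t ht
    rw [projIcc_of_mem _ ht]
  · filter_upwards [MeasureTheory.ae_restrict_mem measurableSet_Icc] with t ht using hbound t ht

/-- Smooth paths which are constant outside of `[0, 1]`; such paths can be concatenated. -/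
def SmoothlyJoinedIn (Ω : Set ℂ) (a b : ℂ) : Prop :=
  ∃ γ : ℝ → ℂ, ContDiff ℝ 1 γ ∧ (∀ t, γ t ∈ Ω) ∧ (∀ t ≤ 0, γ t = a) ∧ ∀ t, 1 ≤ t → γ t = b

lemma SmoothlyJoinedIn.trans {Ω : Set ℂ} {a b c : ℂ} (h₁ : SmoothlyJoinedIn Ω a b)
    (h₂ : SmoothlyJoinedIn Ω b c) : SmoothlyJoinedIn Ω a c := by
  obtain ⟨γ₁, hc₁, hΩ₁, ha₁, hb₁⟩ := h₁
  obtain ⟨γ₂, hc₂, hΩ₂, ha₂, hb₂⟩ := h₂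
  refine ⟨fun t ↦ γ₁ (2 * t) + γ₂ (2 * t - 1) - b, by fun_prop, fun t ↦ ?_, fun t ht ↦ ?_,
    fun t ht ↦ ?_⟩
  · dsimp only
    rcases le_total t (1 / 2) with ht | ht
    · rw [ha₂ _ (by linarith), add_sub_cancel_right]
      exact hΩ₁ _
    · rw [hb₁ _ (by linarith), add_sub_cancel_left]
      exact hΩ₂ _
  · dsimp only
    rw [ha₁ _ (by linarith), ha₂ _ (by linarith), add_sub_cancel_right]
  · dsimp only
    rw [hb₁ _ (by linarith), hb₂ _ (by linarith), add_sub_cancel_left]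

lemma smoothlyJoinedIn_of_convex {Ω s : Set ℂ} (hs : Convex ℝ s) (hsΩ : s ⊆ Ω) {a b : ℂ}
    (ha : a ∈ s) (hb : b ∈ s) : SmoothlyJoinedIn Ω a b := by
  refine ⟨fun t ↦ a + Real.smoothTransition t • (b - a), ?_, fun t ↦ hsΩ ?_, fun t ht ↦ ?_,
    fun t ht ↦ ?_⟩
  · exact contDiff_const.add (Real.smoothTransition.contDiff.smul contDiff_const)
  · exact hs.add_smul_sub_mem ha hb
      ⟨Real.smoothTransition.nonneg t, Real.smoothTransition.le_one t⟩
  · simp [Real.smoothTransition.zero_of_nonpos ht]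
  · simp [Real.smoothTransition.one_of_one_le ht]

lemma IsPlaneDomain.smoothlyJoinedIn {Ω : Set ℂ} (hΩ : IsPlaneDomain Ω) {a b : ℂ} (ha : a ∈ Ω)
    (hb : b ∈ Ω) : SmoothlyJoinedIn Ω a b := by
  refine hΩ.2.isPreconnected.induction₂' (SmoothlyJoinedIn Ω) (fun x hx ↦ ?_)
    (fun _ _ _ _ _ _ ↦ SmoothlyJoinedIn.trans) ha hb
  obtain ⟨ε, hε, hball⟩ := Metric.isOpen_iff.1 hΩ.1 x hx
  filter_upwards [nhdsWithin_le_nhds (ball_mem_nhds x hε)] with y hy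
  exact ⟨smoothlyJoinedIn_of_convex (convex_ball x ε) hball (mem_ball_self hε) hy,
    smoothlyJoinedIn_of_convex (convex_ball x ε) hball hy (mem_ball_self hε)⟩

lemma IsPlaneDomain.exists_isPathIn {Ω : Set ℂ} (hΩ : IsPlaneDomain Ω) {a b : ℂ} (ha : a ∈ Ω)
    (hb : b ∈ Ω) : ∃ γ, IsPathIn Ω a b γ := by
  obtain ⟨γ, hγ, hγΩ, h0, h1⟩ := hΩ.smoothlyJoinedIn ha hb
  exact ⟨γ, h0 0 le_rfl, h1 1 le_rfl, fun t _ ↦ hγΩ t, hγ.contDiffOn⟩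

/-- The inverse of an injective holomorphic function is holomorphic. -/
lemma differentiableOn_invFunOn {Ω : Set ℂ} (hΩ : IsOpen Ω) {h : ℂ → ℂ}
    (hhol : DifferentiableOn ℂ h Ω) (hinj : InjOn h Ω) :
    DifferentiableOn ℂ (Function.invFunOn h Ω) (h '' Ω) := by
  set g := Function.invFunOn h Ω
  have hgh : ∀ z ∈ Ω, g (h z) = z := hinj.leftInvOn_invFunOn
  have hnotconst : ∀ z ∈ Ω, ¬ ∀ᶠ x in nhds z, h x = h z := by
    intro z hz hcon
    have h1 : ∀ᶠ x in nhdsWithin z {z}ᶜ, x = z := by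
      filter_upwards [nhdsWithin_le_nhds (hcon.and (hΩ.mem_nhds hz))] with x hx
      exact hinj hx.2 hz hx.1
    obtain ⟨x, hx, hx'⟩ := (h1.and self_mem_nhdsWithin).exists
    exact hx' hx
  have han : ∀ z ∈ Ω, AnalyticAt ℂ h z := fun z hz ↦ hhol.analyticAt (hΩ.mem_nhds hz)
  have hopen : ∀ z ∈ Ω, nhds (h z) ≤ Filter.map h (nhds z) := fun z hz ↦
    (han z hz).eventually_constant_or_nhds_le_map_nhds.resolve_left (hnotconst z hz)
  have hcont : ∀ z ∈ Ω, ContinuousAt g (h z) := by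
    intro z hz
    rw [ContinuousAt, hgh z hz]
    refine Filter.Tendsto.mono_left (Filter.tendsto_map'_iff.2 ?_) (hopen z hz)
    refine Filter.tendsto_id.congr' ?_
    filter_upwards [hΩ.mem_nhds hz] with x hx using (hgh x hx).symm
  have hright : ∀ y ∈ h '' Ω, h (g y) = y := fun y hy ↦ Function.invFunOn_eq hy
  have himg : ∀ z ∈ Ω, h '' Ω ∈ nhds (h z) := fun z hz ↦
    hopen z hz (Filter.image_mem_map (hΩ.mem_nhds hz))
  rintro _ ⟨z, hz, rfl⟩
  refine DifferentiableAt.differentiableWithinAt (AnalyticAt.differentiableAt ?_)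
  refine analyticAt_of_differentiable_on_punctured_nhds_of_continuousAt ?_ (hcont z hz)
  have hderiv : ∀ᶠ x in nhdsWithin z {z}ᶜ, deriv h x ≠ 0 := by
    refine (han z hz).deriv.eventually_eq_zero_or_eventually_ne_zero.resolve_left fun hcon ↦ ?_
    obtain ⟨ε, hε, hball⟩ := Metric.eventually_nhds_iff_ball.1 (hcon.and (hΩ.mem_nhds hz))
    refine hnotconst z hz (Metric.eventually_nhds_iff_ball.2 ⟨ε, hε, fun x hx ↦ ?_⟩)
    exact isOpen_ball.is_const_of_deriv_eq_zero (convex_ball z ε).isPreconnected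
      (hhol.mono fun y hy ↦ (hball y hy).2) (fun y hy ↦ (hball y hy).1) hx (mem_ball_self hε)
  have htend : Filter.Tendsto g (nhdsWithin (h z) {h z}ᶜ) (nhdsWithin z {z}ᶜ) := by
    refine tendsto_nhdsWithin_iff.2 ⟨?_, ?_⟩
    · have := hcont z hz
      rw [ContinuousAt, hgh z hz] at this
      exact this.mono_left nhdsWithin_le_nhds
    · filter_upwards [self_mem_nhdsWithin, nhdsWithin_le_nhds (himg z hz)] with y hy hy' hgy
      exact hy (by rw [mem_singleton_iff, ← hright y hy', hgy])
  filter_upwards [htend.eventually hderiv, nhdsWithin_le_nhds (himg z hz)] with y hy hy'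
  obtain ⟨x, hx, rfl⟩ := hy'
  rw [hgh x hx] at hy
  refine (HasDerivAt.of_local_left_inverse (f := h) (hcont x hx) (f' := deriv h x) ?_ hy ?_
    ).differentiableAt
  · rw [hgh x hx]
    exact (han x hx).differentiableAt.hasDerivAt
  · filter_upwards [himg x hx] with y hy using hright y hy

/-- Injective holomorphic maps contract the Hurwitz distance. -/
lemma hurwitzDist_map_le {Ω Y : Set ℂ} (hΩ : IsPlaneDomain Ω) (hY : IsPlaneDomain Y)
    (hΩp : Ω ≠ univ) (hYp : Y ≠ univ) {h : ℂ → ℂ} (hhol : DifferentiableOn ℂ h Ω)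
    (hmaps : MapsTo h Ω Y) (hinj : InjOn h Ω) {w₁ w₂ : ℂ} (hw₁ : w₁ ∈ Ω) (hw₂ : w₂ ∈ Ω) :
    hurwitzDist Y (h w₁) (h w₂) ≤ hurwitzDist Ω w₁ w₂ := by
  obtain ⟨γ₀, hγ₀⟩ := hΩ.exists_isPathIn hw₁ hw₂
  refine le_csInf ⟨_, γ₀, hγ₀, rfl⟩ ?_
  rintro _ ⟨γ, hγ, rfl⟩
  obtain ⟨h0, h1, hγΩ, hγd⟩ := id hγ
  have hpath : IsPathIn Y (h w₁) (h w₂) (h ∘ γ) := by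
    refine ⟨by simp [h0], by simp [h1], fun t ht ↦ hmaps (hγΩ t ht), ?_⟩
    exact ((hhol.contDiffOn hΩ.1).restrict_scalars ℝ).comp hγd hγΩ
  refine csInf_le_of_le ⟨0, ?_⟩ ⟨h ∘ γ, hpath, rfl⟩ ?_
  · rintro _ ⟨γ, -, rfl⟩
    exact intervalIntegral.integral_nonneg zero_le_one fun t _ ↦
      mul_nonneg (hurwitzDensity_nonneg _ _) (norm_nonneg _)
  have hint := (intervalIntegrable_iff_integrableOn_Ioc_of_le zero_le_one).1
    (hγ.intervalIntegrable hΩ.1 hΩp)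
  rw [intervalIntegral.integral_of_le zero_le_one, intervalIntegral.integral_of_le zero_le_one]
  refine MeasureTheory.integral_mono_of_nonneg ?_ hint ?_
  · exact .of_forall fun t ↦ mul_nonneg (hurwitzDensity_nonneg _ _) (norm_nonneg _)
  filter_upwards [MeasureTheory.ae_restrict_mem measurableSet_Ioc] with t ht
  have ht' : t ∈ Icc (0 : ℝ) 1 := Ioc_subset_Icc_self ht
  have hγt := (hγd.differentiableOn one_ne_zero t ht').hasDerivWithinAt
  have hht := (hhol.differentiableAt (hΩ.1.mem_nhds (hγΩ t ht'))).hasDerivAt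
  have hcomp := hht.comp_hasDerivWithinAt_of_eq t hγt rfl
  rw [hcomp.derivWithin (uniqueDiffOn_Icc_zero_one t ht'), norm_mul, ← mul_assoc]
  exact mul_le_mul_of_nonneg_right (hurwitzDensity_mul_norm_deriv_le hΩ.1 hΩp hY.1 hYp hhol hmaps
    hinj (hγΩ t ht')) (norm_nonneg _)

/-- injective holomorphic maps are global contractions for the
Hurwitz distance, with equality for conformal homeomorphisms onto `Y`. -/
theorem hurwitz_dist_decreasing_injective
    (Ω Y : Set ℂ) (hΩ : IsPlaneDomain Ω) (hY : IsPlaneDomain Y)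
    (hΩp : Ω ≠ Set.univ) (hYp : Y ≠ Set.univ)
    (h : ℂ → ℂ) (hhol : DifferentiableOn ℂ h Ω) (hmaps : Set.MapsTo h Ω Y)
    (hinj : Set.InjOn h Ω) :
    (∀ w₁ ∈ Ω, ∀ w₂ ∈ Ω, hurwitzDist Y (h w₁) (h w₂) ≤ hurwitzDist Ω w₁ w₂) ∧
    (h '' Ω = Y →
      ∀ w₁ ∈ Ω, ∀ w₂ ∈ Ω, hurwitzDist Y (h w₁) (h w₂) = hurwitzDist Ω w₁ w₂) := by
  refine ⟨fun w₁ hw₁ w₂ hw₂ ↦ hurwitzDist_map_le hΩ hY hΩp hYp hhol hmaps hinj hw₁ hw₂, ?_⟩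
  rintro rfl w₁ hw₁ w₂ hw₂
  refine (hurwitzDist_map_le hΩ hY hΩp hYp hhol hmaps hinj hw₁ hw₂).antisymm ?_
  have hgh := hinj.leftInvOn_invFunOn
  have h1 := hurwitzDist_map_le hY hΩ hYp hΩp (differentiableOn_invFunOn hΩ.1 hhol hinj)
    (fun y hy ↦ Function.invFunOn_mem hy) (Function.invFunOn_injOn_image h Ω)
    (mem_image_of_mem h hw₁) (mem_image_of_mem h hw₂)
  rwa [hgh hw₁, hgh hw₂] at h1
end
end
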